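/- arXiv:2007.03249 — 3 statements merged into one kernel-verified Lean document; each statement's English description precedes it below -/
import Mathlib

section
/- A sequence α ∈ {0,1}^ω is Bernoulli-normal if and only if it is a kollektiv with respect to the set of strategies computable by finite automata; that is, α is Bernoulli-normal if and only if (1) freq_1(α) exists and equals p, and (2) for every deterministic finite automaton M over {0,1} whose selected subsequence M[α] is infinite, freq_1(M[α]) exists and equals p. -/
open Filter

/-- The limiting frequency of `1` (i.e. `true`) in the sequence `β` exists and equals `p`. -/
def Freq1 (β : ℕ → Bool) (p : ℝ) : Prop :=
  Tendsto (fun N : ℕ =>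
    (((Finset.range N).filter fun j => β j = true).card : ℝ) / N) atTop (nhds p)

/-- `α` is Bernoulli-normal (p-distributed): every nonempty finite word `w` occurs as a factor
of `α` with limiting frequency `μ_p(w) = p ^ (number of ones) * (1-p) ^ (number of zeros)`. -/
def BernoulliNormal (p : ℝ) (α : ℕ → Bool) : Prop :=
  ∀ w : List Bool, 1 ≤ w.length →
    Tendsto (fun N : ℕ =>
      (((Finset.range N).filter fun i =>
        ∀ j : Fin w.length, α (i + (j : ℕ)) = w.get j).card : ℝ) / N)
      atTop (nhds ((w.map fun a => if a then p else 1 - p).prod))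

/-- The set of indices `j` selected by the automaton `M` from the sequence `α`: those `j` such
that `M`, started in its start state, is in an accepting state after reading the prefix
`α 0, …, α (j-1)`. -/
def dfaSelSet {σ : Type*} (M : DFA Bool σ) (α : ℕ → Bool) : Set ℕ :=
  {j : ℕ | M.eval (List.ofFn fun i : Fin j => α i) ∈ M.accept}

/-- The subsequence `M[α]` of `α` selected by `M` (meaningful when `dfaSelSet M α` is
infinite), obtained by enumerating the selected indices in increasing order. -/
noncomputable def dfaSubseq {σ : Type*} (M : DFA Bool σ) (α : ℕ → Bool) : ℕ → Bool :=
  fun n => α (Nat.nth (fun j => j ∈ dfaSelSet M α) n)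

/-- A quantitative comparison between a sum and the sum of its sliding windows of length `k`. -/
theorem abs_sum_window_sub_le (f : ℕ → ℝ) (hf : ∀ i, |f i| ≤ 1) (k N : ℕ) :
    |∑ i ∈ Finset.range N, ∑ l ∈ Finset.range k, f (i + l) -
      k * ∑ i ∈ Finset.range N, f i| ≤ 2 * (k : ℝ) ^ 2 := by
  have bound : ∀ (g : ℕ → ℝ), (∀ i, |g i| ≤ 1) → ∀ l, |∑ i ∈ Finset.range l, g i| ≤ l := by
    intro g hg l
    refine (Finset.abs_sum_le_sum_abs _ _).trans ?_
    refine (Finset.sum_le_sum fun i _ => hg i).trans ?_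
    simp
  have shift : ∀ l, ∑ i ∈ Finset.range N, f (i + l) =
      ∑ i ∈ Finset.range N, f i + ∑ i ∈ Finset.range l, f (N + i) -
        ∑ i ∈ Finset.range l, f i := by
    intro l
    have h1 := Finset.sum_range_add f N l
    have h2 := Finset.sum_range_add f l N
    rw [add_comm l N] at h2
    simp only [add_comm _ l]
    linarith
  rw [Finset.sum_comm]
  have : (k : ℝ) * ∑ i ∈ Finset.range N, f i =
      ∑ _l ∈ Finset.range k, ∑ i ∈ Finset.range N, f i := by simp
  rw [this, ← Finset.sum_sub_distrib]
  refine (Finset.abs_sum_le_sum_abs _ _).trans ?_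
  have : ∀ l ∈ Finset.range k,
      |∑ i ∈ Finset.range N, f (i + l) - ∑ i ∈ Finset.range N, f i| ≤ 2 * (k : ℝ) := by
    intro l hl
    have hl' : (l : ℝ) ≤ k := by exact_mod_cast (Finset.mem_range.1 hl).le
    have h1 := abs_le.1 (bound f hf l)
    have h2 := abs_le.1 (bound (fun i => f (N + i)) (fun i => hf _) l)
    rw [shift l, abs_le]
    constructor <;> linarith [h1.1, h1.2, h2.1, h2.2]
  refine (Finset.sum_le_sum this).trans ?_
  simp only [Finset.sum_const, Finset.card_range, nsmul_eq_mul]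
  nlinarith

section Selection

variable (β : ℕ → Bool) (P : ℕ → Prop) [DecidablePred P]

theorem count_nth_selected (N : ℕ) :
    Nat.count (fun n => β (Nat.nth P n) = true) (Nat.count P N) =
      Nat.count (fun j => P j ∧ β j = true) N := by
  induction N with
  | zero => simp
  | succ N ih =>
    rw [Nat.count_succ (p := fun j => P j ∧ β j = true), Nat.count_succ (p := P)]
    by_cases h : P N
    · rw [if_pos h, Nat.count_succ, ih, Nat.nth_count h]
      simp [h]
    · simp [h, ih]

theorem tendsto_count_atTop (hP : {j | P j}.Infinite) :
    Tendsto (fun N => Nat.count P N) atTop atTop :=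
  tendsto_atTop_atTop_of_monotone (Nat.count_monotone P) fun b =>
    ⟨Nat.nth P b, (Nat.count_nth_of_infinite hP b).ge⟩

/-- The frequency of ones in a selected subsequence, in terms of the original indices. -/
theorem freq1_nth_iff (hP : {j | P j}.Infinite) (p : ℝ) :
    Freq1 (fun n => β (Nat.nth P n)) p ↔
      Tendsto (fun N => (Nat.count (fun j => P j ∧ β j = true) N : ℝ) / Nat.count P N)
        atTop (nhds p) := by
  simp only [Freq1, ← Nat.count_eq_card_filter_range]
  constructor
  · intro h
    refine (h.comp (tendsto_count_atTop P hP)).congr fun N => ?_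
    simp only [Function.comp, count_nth_selected]
  · intro h
    refine (h.comp (Nat.nth_strictMono hP).tendsto_atTop).congr fun n => ?_
    simp only [Function.comp, ← count_nth_selected, Nat.count_nth_of_infinite hP]

end Selection

/-- The word `w` occurs in `α` at position `i`. -/
abbrev OccursAt (α : ℕ → Bool) (w : List Bool) (i : ℕ) : Prop :=
  ∀ j : Fin w.length, α (i + (j : ℕ)) = w.get j

/-- The Bernoulli measure of a word. -/
abbrev wordMeasure (p : ℝ) (w : List Bool) : ℝ :=
  (w.map fun a => if a then p else 1 - p).prod

/-- The factor of length `k` of `α` at position `i`. -/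
def factorAt (α : ℕ → Bool) : ℕ → ℕ → List Bool
  | _, 0 => []
  | i, k + 1 => α i :: factorAt α (i + 1) k

theorem occursAt_cons (α : ℕ → Bool) (b : Bool) (w : List Bool) (i : ℕ) :
    OccursAt α (b :: w) i ↔ α i = b ∧ OccursAt α w (i + 1) := by
  constructor
  · intro h
    refine ⟨by simpa using h ⟨0, by simp⟩, fun j => ?_⟩
    have := h ⟨j + 1, by simp⟩
    simpa [add_assoc, add_comm, add_left_comm] using this
  · rintro ⟨h1, h2⟩ ⟨j, hj⟩
    cases j with
    | zero => simpa using h1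
    | succ j =>
      have := h2 ⟨j, by simpa using hj⟩
      simpa [add_assoc, add_comm, add_left_comm] using this

theorem occursAt_append (α : ℕ → Bool) (v w : List Bool) (i : ℕ) :
    OccursAt α (v ++ w) i ↔ OccursAt α v i ∧ OccursAt α w (i + v.length) := by
  induction v generalizing i with
  | nil =>
    have : OccursAt α [] i := fun j => j.elim0
    exact (and_iff_right this).symm
  | cons b v ih =>
    rw [List.cons_append, occursAt_cons, occursAt_cons, ih, and_assoc, List.length_cons]
    simp only [add_assoc, add_comm 1]

theorem occursAt_snoc (α : ℕ → Bool) (w : List Bool) (b : Bool) (i : ℕ) :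
    OccursAt α (w ++ [b]) i ↔ OccursAt α w i ∧ α (i + w.length) = b := by
  have : OccursAt α [] (i + w.length + 1) := fun j => j.elim0
  rw [occursAt_append, occursAt_cons, and_iff_left this]

theorem OccursAt.factorAt_eq {α : ℕ → Bool} {w : List Bool} {i : ℕ} (h : OccursAt α w i) :
    factorAt α i w.length = w := by
  induction w generalizing i with
  | nil => rfl
  | cons b w ih =>
    rw [occursAt_cons] at h
    rw [List.length_cons, factorAt, h.1, ih h.2]

theorem wordMeasure_snoc (p : ℝ) (w : List Bool) (b : Bool) :
    wordMeasure p (w ++ [b]) = wordMeasure p w * if b then p else 1 - p := by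
  simp [wordMeasure]

theorem wordMeasure_pos {p : ℝ} (hp0 : 0 < p) (hp1 : p < 1) (w : List Bool) :
    0 < wordMeasure p w := by
  refine List.prod_pos fun a ha => ?_
  obtain ⟨b, -, rfl⟩ := List.mem_map.1 ha
  split_ifs <;> linarith

theorem tendsto_count_nil (p : ℝ) (α : ℕ → Bool) :
    Tendsto (fun N : ℕ => (Nat.count (OccursAt α []) N : ℝ) / N) atTop
      (nhds (wordMeasure p [])) := by
  have : ∀ i, OccursAt α [] i := fun i j => j.elim0
  refine tendsto_const_nhds.congr' ?_
  filter_upwards [eventually_gt_atTop 0] with N hN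
  have hc : Nat.count (OccursAt α []) N = N := by
    rw [Nat.count_iff_forall]
    exact fun i _ => this i
  rw [hc, div_self (by positivity)]
  simp [wordMeasure]

theorem bernoulliNormal_iff (p : ℝ) (α : ℕ → Bool) :
    BernoulliNormal p α ↔ ∀ w : List Bool,
      Tendsto (fun N : ℕ => (Nat.count (OccursAt α w) N : ℝ) / N) atTop
        (nhds (wordMeasure p w)) := by
  simp only [BernoulliNormal, Nat.count_eq_card_filter_range]
  refine ⟨fun h w => ?_, fun h w _ => h w⟩
  rcases w with _ | ⟨b, w⟩
  · simpa only [Nat.count_eq_card_filter_range] using tendsto_count_nil p α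
  · exact h (b :: w) (by simp)

/-- The expectation of `f` over random words of length `k` with independent letters that are
`true` with probability `p`. -/
def wordExp (p : ℝ) : ℕ → (List Bool → ℝ) → ℝ
  | 0, f => f []
  | k + 1, f =>
    p * wordExp p k (fun w => f (true :: w)) + (1 - p) * wordExp p k (fun w => f (false :: w))

theorem wordExp_add (p : ℝ) (k : ℕ) (f g : List Bool → ℝ) :
    wordExp p k (fun w => f w + g w) = wordExp p k f + wordExp p k g := by
  induction k generalizing f g with
  | zero => rfl
  | succ k ih =>
    simp only [wordExp, ih]
    ring

theorem wordExp_const_mul (p c : ℝ) (k : ℕ) (f : List Bool → ℝ) :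
    wordExp p k (fun w => c * f w) = c * wordExp p k f := by
  induction k generalizing f with
  | zero => rfl
  | succ k ih =>
    simp only [wordExp, ih]
    ring

theorem wordExp_const (p c : ℝ) (k : ℕ) : wordExp p k (fun _ => c) = c := by
  induction k with
  | zero => rfl
  | succ k ih =>
    simp only [wordExp, ih]
    ring

theorem wordExp_sum {ι : Type*} (p : ℝ) (k : ℕ) (s : Finset ι) (f : ι → List Bool → ℝ) :
    wordExp p k (fun w => ∑ q ∈ s, f q w) = ∑ q ∈ s, wordExp p k (f q) := by
  classical
  induction s using Finset.induction_on with
  | empty => simp [wordExp_const]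
  | insert a s ha ih => simp only [Finset.sum_insert ha, wordExp_add, ih]

theorem BernoulliNormal.tendsto_sum_occursAt {p : ℝ} {α : ℕ → Bool} (h : BernoulliNormal p α)
    (k : ℕ) (u : List Bool) (f : List Bool → ℝ) :
    Tendsto (fun N : ℕ => (∑ i ∈ Finset.range N,
      if OccursAt α u i then f (factorAt α (i + u.length) k) else 0) / N) atTop
      (nhds (wordMeasure p u * wordExp p k f)) := by
  induction k generalizing u f with
  | zero =>
    refine (((bernoulliNormal_iff p α).1 h u).mul_const (f [])).congr fun N => ?_
    simp only [factorAt, Nat.count_eq_card_filter_range, ← Finset.sum_filter,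
      Finset.sum_const, nsmul_eq_mul]
    ring
  | succ k ih =>
    have h1 := ih (u ++ [true]) (fun w => f (true :: w))
    have h2 := ih (u ++ [false]) (fun w => f (false :: w))
    have h3 := h1.add h2
    rw [wordMeasure_snoc, wordMeasure_snoc] at h3
    have e : wordMeasure p u * wordExp p (k + 1) f =
        wordMeasure p u * (if true = true then p else 1 - p) *
          wordExp p k (fun w => f (true :: w)) +
        wordMeasure p u * (if false = true then p else 1 - p) *
          wordExp p k (fun w => f (false :: w)) := by
      simp only [wordExp, if_true, Bool.false_eq_true, if_false]
      ring
    rw [e]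
    refine h3.congr fun N => ?_
    rw [← add_div, ← Finset.sum_add_distrib]
    congr 1
    refine Finset.sum_congr rfl fun i _ => ?_
    simp only [occursAt_snoc, factorAt, List.length_append, List.length_singleton, add_assoc]
    by_cases hu : OccursAt α u i
    · cases hb : α (i + u.length) <;> simp
    · simp [hu]

/-- In a Bernoulli-normal sequence, averages over factors converge to expectations. -/
theorem BernoulliNormal.tendsto_average {p : ℝ} {α : ℕ → Bool} (h : BernoulliNormal p α)
    (k : ℕ) (f : List Bool → ℝ) :
    Tendsto (fun N : ℕ => (∑ i ∈ Finset.range N, f (factorAt α i k)) / N) atTop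
      (nhds (wordExp p k f)) := by
  have := h.tendsto_sum_occursAt k [] f
  have hn : ∀ i, OccursAt α [] i := fun i j => j.elim0
  rw [wordMeasure, List.map_nil, List.prod_nil, one_mul] at this
  refine this.congr fun N => ?_
  rw [Finset.sum_congr rfl fun i _ => if_pos (hn i)]
  rfl

section Automaton

variable {σ : Type*} (M : DFA Bool σ)

/-- The state of `M` after reading the first `n` letters of `α`. -/
def runState (α : ℕ → Bool) : ℕ → σ
  | 0 => M.start
  | n + 1 => M.step (runState α n) (α n)

theorem mem_dfaSelSet_iff (α : ℕ → Bool) (j : ℕ) :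
    j ∈ dfaSelSet M α ↔ runState M α j ∈ M.accept := by
  have : M.eval (List.ofFn fun i : Fin j => α i) = runState M α j := by
    induction j with
    | zero => simp [runState]
    | succ j ih =>
      rw [List.ofFn_succ', List.concat_eq_append, DFA.eval_append_singleton, runState, ← ih]
      simp
  rw [dfaSelSet, Set.mem_ofPred_eq, this]

theorem evalFrom_factorAt (α : ℕ → Bool) (i k : ℕ) :
    M.evalFrom (runState M α i) (factorAt α i k) = runState M α (i + k) := by
  induction k generalizing i with
  | zero => rfl
  | succ k ih =>
    rw [factorAt, DFA.evalFrom_cons]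
    exact (ih (i + 1)).trans (by rw [add_assoc, add_comm 1])

/-- There is a word which, read from any state, either visits an accepting state or leads to
a state from which no accepting state can be reached. -/
theorem exists_word_accept_or_dead [Fintype σ] :
    ∃ w : List Bool, ∀ q, (∃ v t, w = v ++ t ∧ M.evalFrom q v ∈ M.accept) ∨
      ∀ x, M.evalFrom (M.evalFrom q w) x ∉ M.accept := by
  classical
  suffices H : ∀ s : Finset σ, ∃ w : List Bool, ∀ q ∈ s,
      (∃ v t, w = v ++ t ∧ M.evalFrom q v ∈ M.accept) ∨
      ∀ x, M.evalFrom (M.evalFrom q w) x ∉ M.accept by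
    obtain ⟨w, hw⟩ := H Finset.univ
    exact ⟨w, fun q => hw q (Finset.mem_univ q)⟩
  intro s
  induction s using Finset.induction_on with
  | empty => exact ⟨[], by simp⟩
  | insert a s ha ih =>
    obtain ⟨w, hw⟩ := ih
    by_cases hd : ∀ x, M.evalFrom (M.evalFrom a w) x ∉ M.accept
    · refine ⟨w, fun q hq => ?_⟩
      rcases Finset.mem_insert.1 hq with rfl | hq
      · exact Or.inr hd
      · exact hw q hq
    · push Not at hd
      obtain ⟨u, hu⟩ := hd
      refine ⟨w ++ u, fun q hq => ?_⟩
      rcases Finset.mem_insert.1 hq with rfl | hq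
      · exact Or.inl ⟨w ++ u, [], by simp, by rwa [DFA.evalFrom_of_append]⟩
      · rcases hw q hq with ⟨v, t, rfl, hv⟩ | hdead
        · exact Or.inl ⟨v, t ++ u, by simp, hv⟩
        · refine Or.inr fun x => ?_
          rw [DFA.evalFrom_of_append, ← DFA.evalFrom_of_append]
          exact hdead (u ++ x)

open scoped Classical in
/-- The selected positions have positive lower density when there are infinitely many. -/
theorem BernoulliNormal.exists_pos_density [Fintype σ] {p : ℝ} (hp0 : 0 < p) (hp1 : p < 1)
    {α : ℕ → Bool} (h : BernoulliNormal p α) (hinf : (dfaSelSet M α).Infinite) :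
    ∃ c : ℝ, 0 < c ∧ ∀ᶠ N : ℕ in atTop,
      c * N ≤ (Nat.count (fun j => j ∈ dfaSelSet M α) N : ℝ) := by
  obtain ⟨w, hw⟩ := exists_word_accept_or_dead M
  set L := w.length + 1 with hL
  have hhit : ∀ i, OccursAt α w i → ∃ l ∈ Finset.range L, i + l ∈ dfaSelSet M α := by
    intro i hi
    rcases hw (runState M α i) with ⟨v, t, rfl, hv⟩ | hdead
    · refine ⟨v.length, by simp [hL], ?_⟩
      have hv' := ((occursAt_append α v t i).1 hi).1.factorAt_eq
      rwa [mem_dfaSelSet_iff, ← evalFrom_factorAt, hv']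
    · exfalso
      obtain ⟨j, hj, hij⟩ := hinf.exists_gt (i + w.length)
      obtain ⟨d, rfl⟩ := Nat.exists_eq_add_of_le hij.le
      rw [mem_dfaSelSet_iff, ← evalFrom_factorAt, ← evalFrom_factorAt, hi.factorAt_eq] at hj
      exact hdead _ hj
  set f : ℕ → ℝ := fun j => if j ∈ dfaSelSet M α then 1 else 0 with hf
  have hf0 : ∀ j, 0 ≤ f j := fun j => by simp only [hf]; split_ifs <;> norm_num
  have hf1 : ∀ j, |f j| ≤ 1 := fun j => by simp only [hf]; split_ifs <;> norm_num
  have hcount : ∀ N, (Nat.count (fun j => j ∈ dfaSelSet M α) N : ℝ) =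
      ∑ j ∈ Finset.range N, f j := by
    intro N
    simp [hf, Nat.count_eq_card_filter_range]
  have hle : ∀ N : ℕ, (Nat.count (OccursAt α w) N : ℝ) ≤
      L * ∑ j ∈ Finset.range N, f j + 2 * (L : ℝ) ^ 2 := by
    intro N
    have h1 := (abs_le.1 (abs_sum_window_sub_le f hf1 L N)).2
    have h2 : (Nat.count (OccursAt α w) N : ℝ) ≤
        ∑ i ∈ Finset.range N, ∑ l ∈ Finset.range L, f (i + l) := by
      rw [Nat.count_eq_card_filter_range, Finset.card_filter]
      push_cast
      refine Finset.sum_le_sum fun i _ => ?_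
      split_ifs with hi
      · obtain ⟨l, hl, hs⟩ := hhit i hi
        refine le_trans ?_ (Finset.single_le_sum (fun l _ => hf0 (i + l)) hl)
        simp [hf, hs]
      · exact Finset.sum_nonneg fun l _ => hf0 _
    linarith
  have hL0 : (0 : ℝ) < L := by positivity
  have hμ := wordMeasure_pos hp0 hp1 w
  set m := wordMeasure p w with hm
  refine ⟨m / 4 / L, by positivity, ?_⟩
  have hfreq := (bernoulliNormal_iff p α).1 h w
  filter_upwards [hfreq.eventually_const_lt (half_lt_self hμ), eventually_gt_atTop 0,
    (tendsto_natCast_atTop_atTop (R := ℝ)).eventually_ge_atTop (8 * (L : ℝ) ^ 2 / m)]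
    with N hN hN0 hN1
  have hN0' : (0 : ℝ) < N := by exact_mod_cast hN0
  rw [lt_div_iff₀ hN0'] at hN
  rw [div_le_iff₀ hμ] at hN1
  have := hle N
  rw [hcount, div_mul_eq_mul_div, div_le_iff₀ hL0]
  nlinarith

/-- The excess of ones over their expected number among the letters of a word selected by `M`
started in state `q`. -/
noncomputable def selectedExcess (p : ℝ) : σ → List Bool → ℝ
  | _, [] => 0
  | q, b :: w => (open scoped Classical in
      if q ∈ M.accept then (if b then 1 else 0) - p else 0) + selectedExcess p (M.step q b) w

theorem wordExp_selectedExcess (p : ℝ) (k : ℕ) (q : σ) :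
    wordExp p k (selectedExcess M p q) = 0 := by
  induction k generalizing q with
  | zero => rfl
  | succ k ih =>
    have h : ∀ q, wordExp p k (fun w => selectedExcess M p q w) = 0 := ih
    simp only [wordExp, selectedExcess, wordExp_add, wordExp_const, h]
    by_cases hq : q ∈ M.accept
    · simp only [hq, if_true, Bool.false_eq_true, if_false]
      ring
    · simp [hq]

theorem wordExp_selectedExcess_sq_le {p : ℝ} (hp0 : 0 < p) (hp1 : p < 1) (k : ℕ) (q : σ) :
    wordExp p k (fun w => selectedExcess M p q w ^ 2) ≤ k := by
  induction k generalizing q with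
  | zero => simp [wordExp, selectedExcess]
  | succ k ih =>
    have h : ∀ q, wordExp p k (fun w => selectedExcess M p q w) = 0 :=
      wordExp_selectedExcess M p k
    have key : ∀ (x : ℝ) (q : σ), wordExp p k (fun w => (x + selectedExcess M p q w) ^ 2) =
        x ^ 2 + wordExp p k (fun w => selectedExcess M p q w ^ 2) := by
      intro x q
      simp only [add_sq, wordExp_add, wordExp_const, wordExp_const_mul, h, mul_zero, add_zero]
    simp only [wordExp, selectedExcess, key]
    have h1 := ih (M.step q true)
    have h2 := ih (M.step q false)
    push_cast
    have h3 := mul_le_mul_of_nonneg_left h1 hp0.le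
    have h4 := mul_le_mul_of_nonneg_left h2 (sub_pos.2 hp1).le
    by_cases hq : q ∈ M.accept
    · simp only [hq, if_true]
      nlinarith
    · simp only [hq, if_false]
      nlinarith

open scoped Classical in
theorem selectedExcess_factorAt (p : ℝ) (α : ℕ → Bool) (i k : ℕ) :
    selectedExcess M p (runState M α i) (factorAt α i k) =
      ∑ l ∈ Finset.range k, if i + l ∈ dfaSelSet M α then
        (if α (i + l) then (1 : ℝ) else 0) - p else 0 := by
  induction k generalizing i with
  | zero => simp [factorAt, selectedExcess]
  | succ k ih =>
    rw [factorAt, selectedExcess, Finset.sum_range_succ', add_comm]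
    refine congrArg₂ _ ((ih (i + 1)).trans ?_) ?_
    · simp only [add_assoc, add_comm 1]
    · simp only [add_zero, ← mem_dfaSelSet_iff]

open scoped Classical in
/-- The excess of ones over their expected number among the selected letters is sublinear. -/
theorem BernoulliNormal.tendsto_excess [Fintype σ] {p : ℝ} (hp0 : 0 < p) (hp1 : p < 1)
    {α : ℕ → Bool} (h : BernoulliNormal p α) :
    Tendsto (fun N : ℕ => (∑ j ∈ Finset.range N, if j ∈ dfaSelSet M α then
        (if α j then (1 : ℝ) else 0) - p else 0) / N) atTop (nhds 0) := by
  set f : ℕ → ℝ := fun j => if j ∈ dfaSelSet M α then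
        (if α j then (1 : ℝ) else 0) - p else 0 with hf
  have hf1 : ∀ j, |f j| ≤ 1 := fun j => by
    simp only [hf]
    split_ifs <;> refine abs_le.2 ⟨?_, ?_⟩ <;> linarith
  rw [Metric.tendsto_atTop']
  intro ε hε
  set C : ℝ := (Fintype.card σ : ℝ) with hC
  have hC0 : 0 ≤ C := by positivity
  obtain ⟨δ, hδ0, hδ⟩ : ∃ δ : ℝ, 0 < δ ∧ 3 * δ < ε := ⟨ε / 4, by linarith, by linarith⟩
  obtain ⟨k, hk⟩ := exists_nat_gt ((C + 1) / δ ^ 2)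
  have hk0 : (0 : ℝ) < k := lt_of_le_of_lt (by positivity) hk
  have hk1 : (1 : ℝ) ≤ k := by
    have : 0 < k := by exact_mod_cast hk0
    exact_mod_cast this
  rw [div_lt_iff₀ (by positivity)] at hk
  set G : List Bool → ℝ := fun w => ∑ q, selectedExcess M p q w ^ 2 with hG
  have hE : wordExp p k G < (C + 1) * k := by
    have : wordExp p k G ≤ C * k := by
      simp only [hG]
      rw [wordExp_sum]
      refine (Finset.sum_le_sum fun q _ => wordExp_selectedExcess_sq_le M hp0 hp1 k q).trans ?_
      simp [hC]
    linarith
  have hwin : ∀ i, |∑ l ∈ Finset.range k, f (i + l)| ≤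
      δ * k + G (factorAt α i k) / (δ * k) := by
    intro i
    have e := selectedExcess_factorAt M p α i k
    have hle : (∑ l ∈ Finset.range k, f (i + l)) ^ 2 ≤ G (factorAt α i k) := by
      rw [← e]
      exact Finset.single_le_sum
        (f := fun q => selectedExcess M p q (factorAt α i k) ^ 2)
        (fun q _ => sq_nonneg _) (Finset.mem_univ (runState M α i))
    set x := ∑ l ∈ Finset.range k, f (i + l)
    have ha : 0 < δ * k := by positivity
    refine le_trans ?_ (add_le_add_right (div_le_div_of_nonneg_right hle ha.le) _)
    rw [← sub_le_iff_le_add', le_div_iff₀ ha]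
    nlinarith [sq_abs x, sq_nonneg (|x| - δ * k), abs_nonneg x]
  have hbound : ∀ N : ℕ, k * |∑ j ∈ Finset.range N, f j| ≤
      N * (δ * k) + (∑ i ∈ Finset.range N, G (factorAt α i k)) / (δ * k) + 2 * (k : ℝ) ^ 2 := by
    intro N
    have h1 := abs_sum_window_sub_le f hf1 k N
    have h2 : |∑ i ∈ Finset.range N, ∑ l ∈ Finset.range k, f (i + l)| ≤
        N * (δ * k) + (∑ i ∈ Finset.range N, G (factorAt α i k)) / (δ * k) := by
      refine (Finset.abs_sum_le_sum_abs _ _).trans ?_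
      refine (Finset.sum_le_sum fun i _ => hwin i).trans ?_
      rw [Finset.sum_add_distrib, Finset.sum_div]
      simp
    have h3 : k * |∑ j ∈ Finset.range N, f j| = |k * ∑ j ∈ Finset.range N, f j| := by
      rw [abs_mul, Nat.abs_cast]
    rw [h3]
    rw [abs_sub_comm] at h1
    have h4 := abs_sub_abs_le_abs_sub (k * ∑ j ∈ Finset.range N, f j)
      (∑ i ∈ Finset.range N, ∑ l ∈ Finset.range k, f (i + l))
    linarith
  have hev : ∀ᶠ N : ℕ in atTop, |∑ j ∈ Finset.range N, f j| < ε * N := by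
    filter_upwards [(h.tendsto_average k G).eventually_lt_const hE, eventually_gt_atTop 0,
      (tendsto_natCast_atTop_atTop (R := ℝ)).eventually_ge_atTop (2 * k / δ)] with N hN hN0 hN1
    have hN0' : (0 : ℝ) < N := by exact_mod_cast hN0
    rw [div_lt_iff₀ hN0'] at hN
    rw [div_le_iff₀ hδ0] at hN1
    have h1 : (∑ i ∈ Finset.range N, G (factorAt α i k)) / (δ * k) ≤ δ * k * N := by
      rw [div_le_iff₀ (by positivity)]
      have : (C + 1) * k * N ≤ k * δ ^ 2 * k * N := by gcongr
      nlinarith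
    have h2 := hbound N
    have h3 : k * |∑ j ∈ Finset.range N, f j| ≤ k * (3 * δ * N) := by
      nlinarith [mul_le_mul_of_nonneg_left hN1 hk0.le]
    have h4 := le_of_mul_le_mul_left h3 hk0
    nlinarith
  obtain ⟨N₀, hN₀⟩ := eventually_atTop.1 (hev.and (eventually_gt_atTop 0))
  refine ⟨N₀, fun N hN => ?_⟩
  obtain ⟨h1, h2⟩ := hN₀ N hN.le
  have h2' : (0 : ℝ) < N := by exact_mod_cast h2
  rw [Real.dist_eq, sub_zero, abs_div, Nat.abs_cast, div_lt_iff₀ h2']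
  exact h1

theorem BernoulliNormal.freq1_dfaSubseq [Fintype σ] {p : ℝ} (hp0 : 0 < p) (hp1 : p < 1)
    {α : ℕ → Bool} (h : BernoulliNormal p α) (hinf : (dfaSelSet M α).Infinite) :
    Freq1 (dfaSubseq M α) p := by
  classical
  refine (freq1_nth_iff α (fun j => j ∈ dfaSelSet M α) hinf p).2 ?_
  obtain ⟨c, hc0, hc⟩ := h.exists_pos_density M hp0 hp1 hinf
  have hT := (h.tendsto_excess M hp0 hp1).abs.div_const c
  rw [abs_zero, zero_div] at hT
  rw [tendsto_iff_dist_tendsto_zero]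
  refine tendsto_of_tendsto_of_tendsto_of_le_of_le' tendsto_const_nhds hT
    (Eventually.of_forall fun _ => dist_nonneg) ?_
  filter_upwards [hc, eventually_gt_atTop 0] with N hN hN0
  have hN0' : (0 : ℝ) < N := by exact_mod_cast hN0
  have hA : (0 : ℝ) < Nat.count (fun j => j ∈ dfaSelSet M α) N :=
    lt_of_lt_of_le (by positivity) hN
  have e : ∑ j ∈ Finset.range N, (if j ∈ dfaSelSet M α then
        (if α j then (1 : ℝ) else 0) - p else 0) =
      (Nat.count (fun j => j ∈ dfaSelSet M α ∧ α j = true) N : ℝ) -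
        p * Nat.count (fun j => j ∈ dfaSelSet M α) N := by
    simp only [Nat.count_eq_card_filter_range, Finset.card_filter, Nat.cast_sum, Nat.cast_ite,
      Nat.cast_one, Nat.cast_zero, Finset.mul_sum, ← Finset.sum_sub_distrib]
    refine Finset.sum_congr rfl fun j _ => ?_
    by_cases h1 : j ∈ dfaSelSet M α <;> by_cases h2 : α j = true <;> simp [h1, h2]
  rw [e, Real.dist_eq, div_sub' hA.ne', mul_comm _ p, abs_div, abs_div, abs_of_pos hA,
    Nat.abs_cast, div_div]
  gcongr
  linarith

end Automaton

/-- A shift register of length `w.length`, accepting when its content is `w`. -/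
def suffixDFA (w : List Bool) : DFA Bool (Fin w.length → Option Bool) where
  step s b i := if h : (i : ℕ) + 1 < w.length then s ⟨i + 1, h⟩ else some b
  start _ := none
  accept := {fun i => some (w.get i)}

theorem runState_suffixDFA (α : ℕ → Bool) (w : List Bool) (n : ℕ) (i : Fin w.length) :
    runState (suffixDFA w) α n i =
      if w.length ≤ n + i then some (α (n + i - w.length)) else none := by
  induction n generalizing i with
  | zero =>
    have := i.2
    simp [runState, suffixDFA]
  | succ n ih =>
    have hi := i.2
    simp only [runState, suffixDFA] at ih ⊢
    split_ifs with h1 h2 h2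
    · rw [ih, if_pos (by simp only; omega)]
      congr 2
      simp only
      omega
    · rw [ih, if_neg (by simp only; omega)]
    · congr 2
      omega
    · omega

theorem mem_dfaSelSet_suffixDFA_of_add (α : ℕ → Bool) (w : List Bool) (i : ℕ) :
    w.length + i ∈ dfaSelSet (suffixDFA w) α ↔ OccursAt α w i := by
  rw [mem_dfaSelSet_iff, show (suffixDFA w).accept = {fun i => some (w.get i)} from rfl,
    Set.mem_singleton_iff, funext_iff]
  refine forall_congr' fun j => ?_
  rw [runState_suffixDFA, if_pos (by omega), Option.some_inj,
    show w.length + i + (j : ℕ) - w.length = i + j by omega]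

theorem notMem_dfaSelSet_suffixDFA (α : ℕ → Bool) (w : List Bool) (n : ℕ) (hn : n < w.length) :
    n ∉ dfaSelSet (suffixDFA w) α := by
  rw [mem_dfaSelSet_iff, show (suffixDFA w).accept = {fun i => some (w.get i)} from rfl,
    Set.mem_singleton_iff]
  intro h
  have := congrFun h ⟨0, by omega⟩
  rw [runState_suffixDFA, if_neg (by simpa using hn)] at this
  cases this

theorem bernoulliNormal_of_freq1_dfaSubseq {p : ℝ} (hp0 : 0 < p) (hp1 : p < 1) {α : ℕ → Bool}
    (h : ∀ (σ : Type) (_ : Fintype σ) (M : DFA Bool σ),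
      (dfaSelSet M α).Infinite → Freq1 (dfaSubseq M α) p) :
    BernoulliNormal p α := by
  classical
  rw [bernoulliNormal_iff]
  intro w
  induction w using List.reverseRecOn with
  | nil => exact tendsto_count_nil p α
  | append_singleton w b ih =>
    have hμ := wordMeasure_pos hp0 hp1 w
    set S := dfaSelSet (suffixDFA w) α with hS
    have hcount : ∀ N, Nat.count (fun j => j ∈ S) (w.length + N) =
        Nat.count (OccursAt α w) N := by
      intro N
      rw [Nat.count_add]
      have : Nat.count (fun j => j ∈ S) w.length = 0 := by
        rw [Nat.count_iff_forall_not]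
        exact fun n hn => notMem_dfaSelSet_suffixDFA α w n hn
      rw [this, zero_add]
      simp only [hS, mem_dfaSelSet_suffixDFA_of_add]
    have hcount1 : ∀ N, Nat.count (fun j => j ∈ S ∧ α j = true) (w.length + N) =
        Nat.count (OccursAt α (w ++ [true])) N := by
      intro N
      rw [Nat.count_add]
      have : Nat.count (fun j => j ∈ S ∧ α j = true) w.length = 0 := by
        rw [Nat.count_iff_forall_not]
        exact fun n hn hn' => notMem_dfaSelSet_suffixDFA α w n hn hn'.1
      rw [this, zero_add]
      simp only [hS, mem_dfaSelSet_suffixDFA_of_add, Nat.count_eq_card_filter_range,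
        occursAt_snoc, add_comm _ w.length]
    have hoccinf : Tendsto (fun N => (Nat.count (OccursAt α w) N : ℝ)) atTop atTop := by
      refine (ih.pos_mul_atTop hμ tendsto_natCast_atTop_atTop).congr' ?_
      filter_upwards [eventually_gt_atTop 0] with N hN
      field_simp
    have hinf : S.Infinite := by
      intro hfin
      obtain ⟨N, hN⟩ := (hoccinf.eventually_gt_atTop (hfin.toFinset.card : ℝ)).exists
      rw [← hcount, Nat.count_eq_card_filter_range, Nat.cast_lt] at hN
      refine absurd (Finset.card_le_card ?_) hN.not_ge
      intro j hj
      simpa using (Finset.mem_filter.1 hj).2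
    have hfreq := (freq1_nth_iff α (fun j => j ∈ S) hinf p).1 (h _ inferInstance _ hinf)
    have hshift : Tendsto (fun N => w.length + N) atTop atTop :=
      tendsto_atTop_mono (fun N => Nat.le_add_left N _) tendsto_id
    have hratio := hfreq.comp hshift
    simp only [Function.comp_def, hcount, hcount1] at hratio
    have htrue : Tendsto (fun N : ℕ => (Nat.count (OccursAt α (w ++ [true])) N : ℝ) / N) atTop
        (nhds (wordMeasure p w * p)) := by
      refine (ih.mul hratio).congr' ?_
      filter_upwards [hoccinf.eventually_gt_atTop 0] with N hN
      field_simp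
    rw [wordMeasure_snoc]
    cases b with
    | true => simpa using htrue
    | false =>
      have hsub := ih.sub htrue
      have e : wordMeasure p w * (if false = true then p else 1 - p) =
          wordMeasure p w - wordMeasure p w * p := by
        simp only [Bool.false_eq_true, if_false]
        ring
      rw [e]
      refine hsub.congr fun N => ?_
      rw [← sub_div]
      congr 1
      simp only [Nat.count_eq_card_filter_range, Finset.card_filter, Nat.cast_sum, Nat.cast_ite,
        Nat.cast_one, Nat.cast_zero, ← Finset.sum_sub_distrib, occursAt_snoc]
      refine Finset.sum_congr rfl fun i _ => ?_
      by_cases hw : OccursAt α w i <;> cases hb : α (i + w.length) <;> simp [hw]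

/-- Agafonov's theorem: a sequence `α ∈ {0,1}^ω` is Bernoulli-normal if and only if it is a
kollektiv w.r.t. the strategies computable by finite automata: (1) the limiting frequency of
ones in `α` is `p`, and (2) for every DFA `M` over `{0,1}` whose selected subsequence `M[α]`
is infinite, the limiting frequency of ones in `M[α]` exists and equals `p`. -/
theorem bernoulliNormal_iff_finiteAutomataKollektiv
    (p : ℝ) (hp0 : 0 < p) (hp1 : p < 1) (α : ℕ → Bool) :
    BernoulliNormal p α ↔
      (Freq1 α p ∧
        ∀ (σ : Type) (_ : Fintype σ) (M : DFA Bool σ),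
          (dfaSelSet M α).Infinite → Freq1 (dfaSubseq M α) p) := by
  refine ⟨fun h => ⟨?_, fun σ _ M hinf => h.freq1_dfaSubseq M hp0 hp1 hinf⟩,
    fun h => bernoulliNormal_of_freq1_dfaSubseq hp0 hp1 h.2⟩
  simpa [Freq1] using h [true] (by simp)
end

section
/- Let A be a deterministic finite automaton over {0,1} with state set Q, let p be a positive Bernoulli distribution on {0,1}, and let b, ε be real numbers with 0 < b ≤ 1 and ε > 0. Then μ_p(G_n(b,ε)) tends to 0 as n → ∞. -/
open Filter
open scoped Classical

/-- `μ_p(w)`: the probability of the finite word `w` under the Bernoulli distribution `p`. -/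
def wordProb (p : Bool → ℝ) (w : List Bool) : ℝ := (w.map p).prod

/-- The word selected from `w` by the strategy `S ⊆ {0,1}*`: the symbols `w_j` (in order)
such that the prefix `w_1 … w_(j-1)` belongs to `S`. -/
noncomputable def selectWord (S : Set (List Bool)) (w : List Bool) : List Bool :=
  (List.finRange w.length).filterMap fun (j : Fin w.length) =>
    if w.take (j : ℕ) ∈ S then some (w.get j) else none

/-- `A_q[w]`: the word picked out from `w` by the automaton `A` started in state `q`. -/
noncomputable def dfaSelect {σ : Type*} (A : DFA Bool σ) (q : σ) (w : List Bool) : List Bool :=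
  selectWord {u | A.evalFrom q u ∈ A.accept} w

/-- The excess of the letter `a` among the symbols selected from `w` by `S`, compared with
the frequency `c`. -/
noncomputable def selectExcess (c : ℝ) (a : Bool) (S : Set (List Bool)) (w : List Bool) : ℝ :=
  ((selectWord S w).count a : ℝ) - c * ((selectWord S w).length : ℝ)

lemma wordProb_cons (p : Bool → ℝ) (x : Bool) (w : List Bool) :
    wordProb p (x :: w) = p x * wordProb p w := by
  simp [wordProb]

lemma wordProb_nonneg {p : Bool → ℝ} (hp : ∀ a, 0 ≤ p a) (w : List Bool) :
    0 ≤ wordProb p w :=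
  List.prod_nonneg fun x hx => by
    obtain ⟨a, -, rfl⟩ := List.mem_map.1 hx
    exact hp a

lemma selectWord_cons (S : Set (List Bool)) (x : Bool) (w : List Bool) :
    selectWord S (x :: w) =
      (if [] ∈ S then [x] else []) ++ selectWord {u | x :: u ∈ S} w := by
  unfold selectWord
  simp only [List.length_cons, List.finRange_succ, List.filterMap_cons, List.filterMap_map]
  by_cases h : [] ∈ S <;> simp [h, Function.comp_def] <;> congr!

lemma selectExcess_nil (c : ℝ) (a : Bool) (S : Set (List Bool)) :
    selectExcess c a S [] = 0 := by
  simp [selectExcess, selectWord]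

lemma selectExcess_cons (c : ℝ) (a : Bool) (S : Set (List Bool)) (x : Bool) (w : List Bool) :
    selectExcess c a S (x :: w) =
      (if [] ∈ S then (if x = a then 1 else 0) - c else 0) +
        selectExcess c a {u | x :: u ∈ S} w := by
  unfold selectExcess
  rw [selectWord_cons]
  by_cases h : [] ∈ S
  · by_cases hx : x = a <;> simp [h, hx] <;> ring
  · simp [h]

lemma sum_bool_word_succ (n : ℕ) (f : List Bool → ℝ) :
    ∑ w : Fin (n + 1) → Bool, f (List.ofFn w) =
      ∑ w : Fin n → Bool, f (true :: List.ofFn w) +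
        ∑ w : Fin n → Bool, f (false :: List.ofFn w) := by
  rw [← (Fin.consEquiv fun _ : Fin (n + 1) => Bool).sum_comp, Fintype.sum_prod_type]
  simp [Fin.consEquiv]

lemma sum_wordProb {p : Bool → ℝ} (hsum : p false + p true = 1) (n : ℕ) :
    ∑ w : Fin n → Bool, wordProb p (List.ofFn w) = 1 := by
  induction n with
  | zero => simp [wordProb]
  | succ n ih =>
    rw [sum_bool_word_succ]
    simp only [wordProb_cons, ← Finset.mul_sum, ih]
    linarith

/-- The selected excess relative to the true frequency has mean zero. -/
lemma sum_wordProb_mul_selectExcess {p : Bool → ℝ} (hsum : p false + p true = 1) (a : Bool)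
    (n : ℕ) (S : Set (List Bool)) :
    ∑ w : Fin n → Bool, wordProb p (List.ofFn w) * selectExcess (p a) a S (List.ofFn w) = 0 := by
  induction n generalizing S with
  | zero => simp [selectExcess_nil]
  | succ n ih =>
    rw [sum_bool_word_succ n fun w => wordProb p w * selectExcess (p a) a S w]
    simp only [wordProb_cons, selectExcess_cons, mul_add, mul_assoc, Finset.sum_add_distrib,
      ← Finset.mul_sum, ← Finset.sum_mul, ih, sum_wordProb hsum]
    have hf : p false = 1 - p true := by linarith
    by_cases h : [] ∈ S <;> cases a <;> simp [h, hf] <;> ring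

/-- The second moment of the selected excess is at most the length of the word. -/
lemma sum_wordProb_mul_selectExcess_sq_le {p : Bool → ℝ} (hpos : ∀ a, 0 < p a)
    (hsum : p false + p true = 1) (a : Bool) (n : ℕ) (S : Set (List Bool)) :
    ∑ w : Fin n → Bool,
      wordProb p (List.ofFn w) * selectExcess (p a) a S (List.ofFn w) ^ 2 ≤ n := by
  induction n generalizing S with
  | zero => simp [selectExcess_nil]
  | succ n ih =>
    have hpa : 0 < p a ∧ p a < 1 := by
      have := hpos true
      have := hpos false
      cases a <;> constructor <;> linarith
    have step : ∀ x : Bool, ∑ w : Fin n → Bool, wordProb p (x :: List.ofFn w) *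
        selectExcess (p a) a S (x :: List.ofFn w) ^ 2 ≤ p x * (n + 1) := by
      intro x
      set k : ℝ := if [] ∈ S then (if x = a then 1 else 0) - p a else 0 with hk
      have hk1 : k ^ 2 ≤ 1 := by
        rw [hk]
        split_ifs <;> nlinarith
      have expand : ∀ w : Fin n → Bool, wordProb p (x :: List.ofFn w) *
          selectExcess (p a) a S (x :: List.ofFn w) ^ 2 =
          p x * (k ^ 2 * wordProb p (List.ofFn w) +
            2 * k * (wordProb p (List.ofFn w) *
              selectExcess (p a) a {u | x :: u ∈ S} (List.ofFn w)) +
            wordProb p (List.ofFn w) *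
              selectExcess (p a) a {u | x :: u ∈ S} (List.ofFn w) ^ 2) := by
        intro w
        rw [wordProb_cons, selectExcess_cons, ← hk]
        ring
      simp only [expand, ← Finset.mul_sum, Finset.sum_add_distrib, sum_wordProb hsum,
        sum_wordProb_mul_selectExcess hsum]
      refine mul_le_mul_of_nonneg_left ?_ (hpos x).le
      linarith [ih {u | x :: u ∈ S}]
    rw [sum_bool_word_succ n fun w => wordProb p w * selectExcess (p a) a S w ^ 2]
    push_cast
    nlinarith [step true, step false]

lemma mul_le_abs_selectExcess {c ε m : ℝ} {a : Bool} {S : Set (List Bool)} {w : List Bool}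
    (hm : 0 ≤ m) (hlen : m < ((selectWord S w).length : ℝ))
    (hdev : ε ≤ |((selectWord S w).count a : ℝ) / ((selectWord S w).length : ℝ) - c|) :
    ε * m ≤ |selectExcess c a S w| := by
  have hL := hm.trans_lt hlen
  calc ε * m ≤ |((selectWord S w).count a : ℝ) / ((selectWord S w).length : ℝ) - c| *
        (selectWord S w).length := mul_le_mul hdev hlen.le hm (abs_nonneg _)
    _ = |selectExcess c a S w| := by
      rw [← abs_of_pos hL, ← abs_mul, abs_of_pos hL, selectExcess]
      congr 1
      field_simp

/-- For `G_n(b,ε) = ∪_q G_n(b,ε,q)` where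
`G_n(b,ε,q) = {w ∈ {0,1}^n : |A_q[w]| > b·n and max_a |#_a(A_q[w])/|A_q[w]| - p(a)| ≥ ε}`,
we have `μ_p(G_n(b,ε)) → 0` as `n → ∞`. -/
theorem mu_G_tendsto_zero {σ : Type} [Fintype σ] (A : DFA Bool σ)
    (p : Bool → ℝ) (hpos : ∀ a, 0 < p a) (hsum : p false + p true = 1)
    (b ε : ℝ) (hb0 : 0 < b) (hb1 : b ≤ 1) (hε : 0 < ε) :
    Tendsto (fun n : ℕ =>
      ∑ w : Fin n → Bool,
        if (∃ q : σ,
            b * n < ((dfaSelect A q (List.ofFn w)).length : ℝ) ∧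
            ∃ a : Bool,
              ε ≤ |((dfaSelect A q (List.ofFn w)).count a : ℝ) /
                    ((dfaSelect A q (List.ofFn w)).length : ℝ) - p a|)
        then wordProb p (List.ofFn w) else 0)
      atTop (nhds 0) := by
  have bound : Tendsto (fun n : ℕ =>
      (∑ _q : σ, ∑ _a : Bool, 1 / (ε * b) ^ 2) * (1 / (n : ℝ))) atTop (nhds 0) := by
    simpa only [mul_zero] using (tendsto_one_div_atTop_nhds_zero_nat (𝕜 := ℝ)).const_mul
      (∑ _q : σ, ∑ _a : Bool, 1 / (ε * b) ^ 2)
  have hP := wordProb_nonneg fun a => (hpos a).le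
  refine squeeze_zero' (Eventually.of_forall fun n => Finset.sum_nonneg fun w _ => ?_) ?_ bound
  · split_ifs
    exacts [hP _, le_rfl]
  filter_upwards [eventually_gt_atTop 0] with n hn
  have hn : (0 : ℝ) < n := by exact_mod_cast hn
  let D (q : σ) (a : Bool) (w : Fin n → Bool) : ℝ :=
    selectExcess (p a) a {u | A.evalFrom q u ∈ A.accept} (List.ofFn w)
  have hterm : ∀ q a w, 0 ≤ 1 / (ε * (b * n)) ^ 2 * (wordProb p (List.ofFn w) * D q a w ^ 2) :=
    fun q a w => mul_nonneg (by positivity) (mul_nonneg (hP _) (sq_nonneg _))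
  calc _ ≤ ∑ w : Fin n → Bool, ∑ q : σ, ∑ a : Bool,
        1 / (ε * (b * n)) ^ 2 * (wordProb p (List.ofFn w) * D q a w ^ 2) := by
        refine Finset.sum_le_sum fun w _ => ?_
        split_ifs with h
        · obtain ⟨q, hlen, a, hdev⟩ := h
          have hD : ε * (b * n) ≤ |D q a w| :=
            mul_le_abs_selectExcess (by positivity) hlen hdev
          have hsq : (ε * (b * n)) ^ 2 ≤ D q a w ^ 2 := by
            rw [← sq_abs (D q a w)]
            gcongr
          calc wordProb p (List.ofFn w)
              ≤ 1 / (ε * (b * n)) ^ 2 * (wordProb p (List.ofFn w) * D q a w ^ 2) := by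
                rw [one_div_mul_eq_div, le_div_iff₀ (by positivity)]
                exact mul_le_mul_of_nonneg_left hsq (hP _)
            _ ≤ ∑ a : Bool, 1 / (ε * (b * n)) ^ 2 * (wordProb p (List.ofFn w) * D q a w ^ 2) :=
                Finset.single_le_sum (fun a _ => hterm q a w) (Finset.mem_univ a)
            _ ≤ _ := Finset.single_le_sum
                (f := fun q => ∑ a : Bool,
                  1 / (ε * (b * n)) ^ 2 * (wordProb p (List.ofFn w) * D q a w ^ 2))
                (fun q _ => Finset.sum_nonneg fun a _ => hterm q a w) (Finset.mem_univ q)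
        · exact Finset.sum_nonneg fun q _ => Finset.sum_nonneg fun a _ => hterm q a w
    _ = ∑ q : σ, ∑ a : Bool, 1 / (ε * (b * n)) ^ 2 *
        ∑ w : Fin n → Bool, wordProb p (List.ofFn w) * D q a w ^ 2 := by
        rw [Finset.sum_comm]
        refine Finset.sum_congr rfl fun q _ => ?_
        rw [Finset.sum_comm]
        simp only [Finset.mul_sum]
    _ ≤ ∑ q : σ, ∑ a : Bool, 1 / (ε * (b * n)) ^ 2 * n := by
        gcongr with q _ a _
        exact sum_wordProb_mul_selectExcess_sq_le hpos hsum a n _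
    _ = _ := by
        simp only [Finset.sum_mul]
        refine Finset.sum_congr rfl fun q _ => Finset.sum_congr rfl fun a _ => ?_
        field_simp
end

section
/- Lebesgue-almost every real number x ∈ (0,1) is absolutely normal: for every integer base b ≥ 2, every m ≥ 1, and every word w of length m over the digit alphabet {0,1,…,b−1}, the limit as N → ∞ of (number of occurrences of w as a factor among the first N digits of the base-b expansion of x)/N exists and equals b^{−m}. -/
open Filter MeasureTheory
open scoped Classical

/-- The `n`-th digit (for `n ≥ 1`) of the base-`b` expansion of `x ∈ (0,1)`:
`d_n = ⌊x·b^n⌋ mod b`.  (This is the expansion that does not end in an infinite tail of the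
digit `b-1`.) -/
noncomputable def baseDigit (b : ℕ) (x : ℝ) (n : ℕ) : ℕ :=
  (⌊x * (b : ℝ) ^ n⌋ % (b : ℤ)).toNat

open ProbabilityTheory

/-- Lebesgue measure on the unit interval `[0,1)`. -/
noncomputable abbrev unitMeasure : Measure ℝ := volume.restrict (Set.Ico 0 1)

instance isProbabilityMeasure_unitMeasure : IsProbabilityMeasure unitMeasure :=
  ⟨by simp [unitMeasure]⟩

lemma unitMeasure_floor_eq_fract_mem {n : ℕ} (hn : 0 < n) (k : ℤ) {t : Set ℝ}
    (ht : MeasurableSet t) :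
    unitMeasure {x | ⌊x * n⌋ = k ∧ Int.fract (x * n) ∈ t} =
      (if 0 ≤ k ∧ k < n then (n : ENNReal)⁻¹ else 0) * unitMeasure t := by
  have hn' : (0 : ℝ) < n := by exact_mod_cast hn
  have hm : Measurable fun x : ℝ => x * n := measurable_id.mul_const _
  have hS : MeasurableSet {x : ℝ | ⌊x * n⌋ = k ∧ Int.fract (x * n) ∈ t} :=
    (hm.floor (measurableSet_singleton k)).inter (hm.fract ht)
  rw [unitMeasure, Measure.restrict_apply hS, Measure.restrict_apply ht]
  split_ifs with h
  · have hset : {x : ℝ | ⌊x * n⌋ = k ∧ Int.fract (x * n) ∈ t} ∩ Set.Ico 0 1 =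
        (fun x : ℝ => x * n) ⁻¹' ((fun y : ℝ => y + (-k : ℝ)) ⁻¹' (t ∩ Set.Ico 0 1)) := by
      have hk0 : (0 : ℝ) ≤ k := by exact_mod_cast h.1
      have hk1 : (k : ℝ) + 1 ≤ n := by exact_mod_cast h.2
      ext x
      simp only [Set.mem_inter_iff, Set.mem_ofPred_eq, Set.mem_Ico, Set.mem_preimage]
      constructor
      · rintro ⟨⟨h1, h2⟩, -⟩
        have hf : x * n + -k = Int.fract (x * n) := by rw [Int.fract, h1]; ring
        rw [hf]
        exact ⟨h2, Int.fract_nonneg _, Int.fract_lt_one _⟩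
      · rintro ⟨h1, h2, h3⟩
        have hfl : ⌊x * n⌋ = k := Int.floor_eq_iff.2 ⟨by linarith, by linarith⟩
        have hf : x * n + -k = Int.fract (x * n) := by rw [Int.fract, hfl]; ring
        refine ⟨⟨hfl, hf ▸ h1⟩, ?_, ?_⟩
        · exact nonneg_of_mul_nonneg_left (by linarith) hn'
        · exact lt_of_mul_lt_mul_right (by linarith) hn'.le
    rw [hset, Real.volume_preimage_mul_right hn'.ne', measure_preimage_add_right,
      abs_of_pos (inv_pos.2 hn'), ENNReal.ofReal_inv_of_pos hn', ENNReal.ofReal_natCast]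
  · rw [zero_mul]
    convert measure_empty (μ := (volume : Measure ℝ))
    rw [Set.eq_empty_iff_forall_notMem]
    rintro x ⟨⟨h1, -⟩, h2, h3⟩
    refine h ⟨h1 ▸ Int.floor_nonneg.2 (by positivity), ?_⟩
    rw [← h1, Int.floor_lt]
    push_cast
    nlinarith

lemma unitMeasure_floor_eq {n : ℕ} (hn : 0 < n) (k : ℤ) :
    unitMeasure {x | ⌊x * n⌋ = k} = if 0 ≤ k ∧ k < n then (n : ENNReal)⁻¹ else 0 := by
  simpa using unitMeasure_floor_eq_fract_mem hn k MeasurableSet.univ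

lemma unitMeasure_floor_mem_fract_mem {n : ℕ} (hn : 0 < n) (s : Set ℤ) {t : Set ℝ}
    (ht : MeasurableSet t) :
    unitMeasure ((fun x : ℝ => ⌊x * n⌋) ⁻¹' s ∩ (fun x : ℝ => Int.fract (x * n)) ⁻¹' t) =
      unitMeasure ((fun x : ℝ => ⌊x * n⌋) ⁻¹' s) * unitMeasure t := by
  have hm : Measurable fun x : ℝ => x * n := measurable_id.mul_const _
  have hfl : ∀ u : Set ℤ, MeasurableSet ((fun x : ℝ => ⌊x * n⌋) ⁻¹' u) :=
    fun u => hm.floor (MeasurableSet.of_discrete)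
  rw [← Measure.restrict_apply (hfl s),
    ← tsum_measure_preimage_singleton s.to_countable fun y _ => hfl {y},
    ← tsum_measure_preimage_singleton s.to_countable fun y _ => hfl {y}, ← ENNReal.tsum_mul_right]
  refine tsum_congr fun k => ?_
  rw [Measure.restrict_apply (hfl _)]
  exact (unitMeasure_floor_eq_fract_mem hn k ht).trans
    (congrArg (· * _) (unitMeasure_floor_eq hn k).symm)

lemma measurePreserving_fract_mul {n : ℕ} (hn : 0 < n) :
    MeasurePreserving (fun x : ℝ => Int.fract (x * n)) unitMeasure unitMeasure := by
  have hm : Measurable fun x : ℝ => Int.fract (x * n) := (measurable_id.mul_const _).fract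
  refine ⟨hm, Measure.ext fun t ht => ?_⟩
  rw [Measure.map_apply hm ht]
  simpa using unitMeasure_floor_mem_fract_mem hn Set.univ ht

lemma indepFun_floor_mul_fract_mul {n : ℕ} (hn : 0 < n) :
    IndepFun (fun x : ℝ => ⌊x * n⌋) (fun x : ℝ => Int.fract (x * n)) unitMeasure := by
  rw [indepFun_iff_measure_inter_preimage_eq_mul]
  intro s t _ ht
  rw [unitMeasure_floor_mem_fract_mem hn s ht,
    (measurePreserving_fract_mul hn).measure_preimage ht.nullMeasurableSet]

lemma fract_fract_mul_natCast (y : ℝ) (n : ℕ) :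
    Int.fract (Int.fract y * n) = Int.fract (y * n) := by
  have h : Int.fract y * n = y * n - ((⌊y⌋ * n : ℤ) : ℝ) := by
    rw [Int.fract]; push_cast; ring
  rw [h, Int.fract_sub_intCast]

lemma baseDigit_fract (b : ℕ) (x : ℝ) (i l : ℕ) :
    baseDigit b (Int.fract (x * (b : ℝ) ^ i)) (l + 1) = baseDigit b x (i + l + 1) := by
  have h : Int.fract (x * (b : ℝ) ^ i) * (b : ℝ) ^ (l + 1) =
      x * (b : ℝ) ^ (i + l + 1) - ((⌊x * (b : ℝ) ^ i⌋ * b ^ l * b : ℤ) : ℝ) := by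
    rw [Int.fract]; push_cast; ring
  rw [baseDigit, baseDigit, h, Int.floor_sub_intCast, Int.sub_mul_emod_self_right]

lemma baseDigit_eq_floor_div {b : ℕ} (hb : 0 < b) (x : ℝ) (l k : ℕ) :
    baseDigit b x l = (⌊x * ((b ^ (l + k) : ℕ) : ℝ)⌋ / ((b ^ k : ℕ) : ℤ) % (b : ℤ)).toNat := by
  rw [baseDigit, ← Int.floor_div_natCast]
  have hb' : (b : ℝ) ≠ 0 := by exact_mod_cast hb.ne'
  congr 3
  push_cast
  field_simp
  ring

/-- The reals whose base-`b` digit sequence starts with `w`. -/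
def digitCylinder (b : ℕ) (w : List ℕ) : Set ℝ :=
  {x | ∀ j : Fin w.length, baseDigit b x (j + 1) = w.get j}

lemma measurable_baseDigit (b n : ℕ) : Measurable fun x => baseDigit b x n :=
  (measurable_of_countable fun z : ℤ => (z % (b : ℤ)).toNat).comp
    (measurable_id.mul_const ((b : ℝ) ^ n)).floor

lemma measurableSet_digitCylinder (b : ℕ) (w : List ℕ) : MeasurableSet (digitCylinder b w) := by
  rw [digitCylinder, Set.ofPred_forall]
  exact MeasurableSet.iInter fun j => measurable_baseDigit b _ (measurableSet_singleton _)

lemma fract_mem_digitCylinder_iff (b : ℕ) (w : List ℕ) (x : ℝ) (i : ℕ) :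
    Int.fract (x * (b : ℝ) ^ i) ∈ digitCylinder b w ↔
      ∀ j : Fin w.length, baseDigit b x (i + j + 1) = w.get j := by
  simp only [digitCylinder, Set.mem_ofPred_eq, baseDigit_fract]

lemma unitMeasure_digitCylinder {b : ℕ} (hb : 0 < b) (w : List ℕ) (hw : ∀ d ∈ w, d < b) :
    unitMeasure (digitCylinder b w) = ((b : ENNReal) ^ w.length)⁻¹ := by
  induction w with
  | nil => simp [digitCylinder]
  | cons d w ih =>
    have hd : d < b := hw d (by simp)
    have hcongr : digitCylinder b (d :: w) =ᵐ[unitMeasure]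
        {x | ⌊x * b⌋ = (d : ℤ) ∧ Int.fract (x * b) ∈ digitCylinder b w} := by
      filter_upwards [ae_restrict_mem measurableSet_Ico] with x hx
      have hx0 : 0 ≤ ⌊x * b⌋ := Int.floor_nonneg.2 (mul_nonneg hx.1 b.cast_nonneg)
      have hx1 : ⌊x * b⌋ < b := by
        have : (0 : ℝ) < b := by exact_mod_cast hb
        rw [Int.floor_lt]
        push_cast
        nlinarith [hx.2]
      have hiff := fract_mem_digitCylinder_iff b w x 1
      rw [pow_one] at hiff
      refine propext ?_
      change (∀ j : Fin (w.length + 1), baseDigit b x (j + 1) = (d :: w).get j) ↔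
        ⌊x * b⌋ = (d : ℤ) ∧ Int.fract (x * b) ∈ digitCylinder b w
      rw [hiff, Fin.forall_fin_succ]
      refine and_congr ?_ (forall_congr' fun j => ?_)
      · simp only [baseDigit, Fin.val_zero, zero_add, pow_one, Int.emod_eq_of_lt hx0 hx1,
          List.get_cons_zero]
        omega
      · simp [add_comm 1]
    rw [measure_congr hcongr, unitMeasure_floor_eq_fract_mem hb _ (measurableSet_digitCylinder b w),
      if_pos ⟨by positivity, by exact_mod_cast hd⟩, ih fun e he => hw e (by simp [he]),
      List.length_cons, pow_succ', ENNReal.mul_inv (by simp [hb.ne']) (by simp)]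

/-- The indicator function of the occurrence of `w` right after the first `i` digits of the
base-`b` expansion. -/
noncomputable def occurrenceIndicator (b : ℕ) (w : List ℕ) (i : ℕ) : ℝ → ℝ :=
  (digitCylinder b w).indicator 1 ∘ fun x => Int.fract (x * ((b ^ i : ℕ) : ℝ))

lemma measurable_indicator_digitCylinder (b : ℕ) (w : List ℕ) :
    Measurable ((digitCylinder b w).indicator (1 : ℝ → ℝ)) :=
  measurable_one.indicator (measurableSet_digitCylinder b w)

lemma occurrenceIndicator_apply (b : ℕ) (w : List ℕ) (i : ℕ) (x : ℝ) :
    occurrenceIndicator b w i x =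
      if ∀ j : Fin w.length, baseDigit b x (i + j + 1) = w.get j then 1 else 0 := by
  simp only [occurrenceIndicator, Function.comp_apply, Set.indicator_apply, Nat.cast_pow,
    fract_mem_digitCylinder_iff, Pi.one_apply]

lemma integrable_indicator_digitCylinder (b : ℕ) (w : List ℕ) :
    Integrable ((digitCylinder b w).indicator (1 : ℝ → ℝ)) unitMeasure :=
  (integrable_const (1 : ℝ)).indicator (measurableSet_digitCylinder b w)

lemma integrable_occurrenceIndicator {b : ℕ} (hb : 0 < b) (w : List ℕ) (i : ℕ) :
    Integrable (occurrenceIndicator b w i) unitMeasure :=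
  (measurePreserving_fract_mul (pow_pos hb i)).integrable_comp_of_integrable
    (integrable_indicator_digitCylinder b w)

lemma integral_occurrenceIndicator {b : ℕ} (hb : 0 < b) (w : List ℕ) (hw : ∀ d ∈ w, d < b)
    (i : ℕ) : ∫ x, occurrenceIndicator b w i x ∂unitMeasure = ((b : ℝ) ^ w.length)⁻¹ := by
  have hT := measurePreserving_fract_mul (pow_pos hb i)
  have h := integral_map (μ := unitMeasure) hT.measurable.aemeasurable
    (measurable_indicator_digitCylinder b w).aestronglyMeasurable
  rw [hT.map_eq, integral_indicator_one (measurableSet_digitCylinder b w), measureReal_def,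
    unitMeasure_digitCylinder hb w hw] at h
  simpa [occurrenceIndicator] using h.symm

lemma identDistrib_occurrenceIndicator {b : ℕ} (hb : 0 < b) (w : List ℕ) (i k : ℕ) :
    IdentDistrib (occurrenceIndicator b w i) (occurrenceIndicator b w k)
      unitMeasure unitMeasure := by
  have hi := measurePreserving_fract_mul (pow_pos hb i)
  have hk := measurePreserving_fract_mul (pow_pos hb k)
  exact IdentDistrib.comp
    ⟨hi.measurable.aemeasurable, hk.measurable.aemeasurable, hi.map_eq.trans hk.map_eq.symm⟩
    (measurable_indicator_digitCylinder b w)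

lemma indepFun_occurrenceIndicator {b : ℕ} (hb : 0 < b) (w : List ℕ) {i k : ℕ}
    (hik : i + w.length ≤ k) :
    IndepFun (occurrenceIndicator b w i) (occurrenceIndicator b w k) unitMeasure := by
  let F : ℤ → ℝ := fun z =>
    if ∀ j : Fin w.length,
      (z / ((b ^ (w.length - (j + 1)) : ℕ) : ℤ) % (b : ℤ)).toNat = w.get j then 1 else 0
  let G : ℝ → ℝ := fun y =>
    (digitCylinder b w).indicator 1 (Int.fract (y * ((b ^ (k - (i + w.length)) : ℕ) : ℝ)))
  have hF : occurrenceIndicator b w i = F ∘ fun x => ⌊x * ((b ^ (i + w.length) : ℕ) : ℝ)⌋ := by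
    funext x
    rw [occurrenceIndicator_apply]
    refine if_congr (forall_congr' fun j => ?_) rfl rfl
    rw [baseDigit_eq_floor_div hb x (i + j + 1) (w.length - (j + 1)),
      show i + (j : ℕ) + 1 + (w.length - (j + 1)) = i + w.length by omega]
  have hG : occurrenceIndicator b w k =
      G ∘ fun x => Int.fract (x * ((b ^ (i + w.length) : ℕ) : ℝ)) := by
    funext x
    simp only [occurrenceIndicator, G, Function.comp_apply, fract_fract_mul_natCast]
    rw [mul_assoc, ← Nat.cast_mul, ← pow_add, Nat.add_sub_cancel' hik]
  rw [hF, hG]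
  exact (indepFun_floor_mul_fract_mul (pow_pos hb _)).comp (measurable_of_countable F)
    ((measurable_indicator_digitCylinder b w).comp (measurable_id.mul_const _).fract)

lemma sum_range_mul_eq_sum_sum {M : Type*} [AddCommMonoid M] (a : ℕ → M) (m K : ℕ) :
    ∑ i ∈ Finset.range (K * m), a i =
      ∑ r ∈ Finset.range m, ∑ k ∈ Finset.range K, a (r + k * m) := by
  induction K with
  | zero => simp
  | succ K ih =>
    rw [Nat.succ_mul, Finset.sum_range_add, ih]
    simp only [Finset.sum_range_succ, Finset.sum_add_distrib, Nat.add_comm (K * m)]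

/-- A bounded sequence whose averages along each residue class modulo `m` tend to `0` has averages
tending to `0`. -/
lemma tendsto_average_zero_of_residues {a : ℕ → ℝ} {C : ℝ} (hC : ∀ i, |a i| ≤ C) {m : ℕ}
    (hm : 0 < m)
    (h : ∀ r < m, Tendsto (fun n : ℕ => (∑ k ∈ Finset.range n, a (r + k * m)) / n) atTop (nhds 0)) :
    Tendsto (fun n : ℕ => (∑ i ∈ Finset.range n, a i) / n) atTop (nhds 0) := by
  have hC0 : 0 ≤ C := (abs_nonneg _).trans (hC 0)
  have hblock : Tendsto (fun K : ℕ => |(∑ i ∈ Finset.range (K * m), a i) / K|) atTop (nhds 0) := by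
    have := tendsto_finsetSum (Finset.range m) fun r hr => h r (Finset.mem_range.1 hr)
    simpa [sum_range_mul_eq_sum_sum, Finset.sum_div] using this.abs
  have hrem : Tendsto (fun n : ℕ => (m * C) / (n : ℝ)) atTop (nhds 0) :=
    tendsto_const_div_atTop_nhds_zero_nat _
  have hbound := (hblock.comp (Nat.tendsto_div_const_atTop hm.ne')).add hrem
  rw [add_zero] at hbound
  refine squeeze_zero_norm' ?_ hbound
  filter_upwards [eventually_ge_atTop m] with n hn
  have hK : 0 < n / m := Nat.div_pos hn hm
  have hK' : (0 : ℝ) < (n / m : ℕ) := by exact_mod_cast hK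
  have hKn : ((n / m : ℕ) : ℝ) ≤ n := by exact_mod_cast Nat.div_le_self n m
  have hsplit : ∑ i ∈ Finset.range n, a i = ∑ i ∈ Finset.range (n / m * m), a i +
      ∑ i ∈ Finset.range (n % m), a (n / m * m + i) := by
    rw [← Finset.sum_range_add, Nat.div_add_mod']
  have htail : |∑ i ∈ Finset.range (n % m), a (n / m * m + i)| ≤ m * C := by
    refine (Finset.abs_sum_le_sum_abs _ _).trans ((Finset.sum_le_card_nsmul _ _ C
      fun i _ => hC _).trans ?_)
    rw [Finset.card_range, nsmul_eq_mul]
    gcongr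
    exact (Nat.mod_lt n hm).le
  rw [hsplit, add_div, Real.norm_eq_abs]
  refine (abs_add_le _ _).trans (add_le_add ?_ ?_)
  · simp only [Function.comp_apply, abs_div, Nat.abs_cast]
    gcongr
  · rw [abs_div, Nat.abs_cast]
    gcongr

/-- A bounded sequence whose averages along each residue class modulo `m` tend to `L` has averages
tending to `L`. -/
lemma tendsto_average_of_residues {a : ℕ → ℝ} {C L : ℝ} (hC : ∀ i, |a i| ≤ C) {m : ℕ}
    (hm : 0 < m)
    (h : ∀ r < m, Tendsto (fun n : ℕ => (∑ k ∈ Finset.range n, a (r + k * m)) / n) atTop (nhds L)) :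
    Tendsto (fun n : ℕ => (∑ i ∈ Finset.range n, a i) / n) atTop (nhds L) := by
  have key : ∀ c : ℕ → ℝ, Tendsto (fun n : ℕ => (∑ i ∈ Finset.range n, (c i - L)) / n) atTop
      (nhds 0) ↔ Tendsto (fun n : ℕ => (∑ i ∈ Finset.range n, c i) / n) atTop (nhds L) := by
    intro c
    rw [← tendsto_sub_nhds_zero_iff (x := L)]
    refine tendsto_congr' ?_
    filter_upwards [eventually_gt_atTop 0] with n hn
    have : (n : ℝ) ≠ 0 := by exact_mod_cast hn.ne'
    simp only [Finset.sum_sub_distrib, Finset.sum_const, Finset.card_range, nsmul_eq_mul]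
    field_simp
  refine (key a).1 (tendsto_average_zero_of_residues (a := fun i => a i - L) (C := C + |L|)
    (fun i => (abs_sub _ _).trans (by gcongr; exact hC i)) hm fun r hr => (key _).2 (h r hr))

lemma ae_tendsto_average_occurrenceIndicator {b : ℕ} (hb : 0 < b) {w : List ℕ}
    (hw0 : 0 < w.length) (hw : ∀ d ∈ w, d < b) :
    ∀ᵐ x ∂unitMeasure, Tendsto
      (fun n : ℕ => (∑ i ∈ Finset.range n, occurrenceIndicator b w i x) / n) atTop
      (nhds ((b : ℝ) ^ w.length)⁻¹) := by
  have hres : ∀ r : ℕ, ∀ᵐ x ∂unitMeasure, Tendsto (fun n : ℕ =>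
      (∑ k ∈ Finset.range n, occurrenceIndicator b w (r + k * w.length) x) / n) atTop
      (nhds ((b : ℝ) ^ w.length)⁻¹) := by
    intro r
    have hlt : ∀ i k : ℕ, i < k → r + i * w.length + w.length ≤ r + k * w.length := by
      intro i k hik
      have := Nat.mul_le_mul_right w.length (Nat.succ_le_of_lt hik)
      rw [Nat.succ_mul] at this
      omega
    have h := strong_law_ae_real (fun k => occurrenceIndicator b w (r + k * w.length))
      (integrable_occurrenceIndicator hb w _)
      (fun i k hik => by
        rcases hik.lt_or_gt with hlt' | hlt'
        · exact indepFun_occurrenceIndicator hb w (hlt i k hlt')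
        · exact (indepFun_occurrenceIndicator hb w (hlt k i hlt')).symm)
      (fun i => identDistrib_occurrenceIndicator hb w _ _)
    rwa [integral_occurrenceIndicator hb w hw] at h
  filter_upwards [ae_all_iff.2 hres] with x hx
  refine tendsto_average_of_residues (C := 1) (fun i => ?_) hw0 fun r _ => hx r
  rw [occurrenceIndicator_apply]
  split_ifs <;> simp

/-- Borel's theorem: Lebesgue-almost every `x ∈ (0,1)` is absolutely normal: for every base
`b ≥ 2` and every nonempty word `w` over the digits `{0, …, b-1}`, the limiting frequency of
occurrences of `w` as a factor of the base-`b` digit sequence of `x` exists and equals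
`b^(-|w|)`. -/
theorem ae_absolutely_normal :
    ∀ᵐ x ∂(volume.restrict (Set.Ioo (0 : ℝ) 1)),
      ∀ b : ℕ, 2 ≤ b → ∀ w : List ℕ, 1 ≤ w.length → (∀ d ∈ w, d < b) →
        Tendsto (fun N : ℕ =>
          (((Finset.range N).filter fun i =>
            ∀ j : Fin w.length, baseDigit b x (i + (j : ℕ) + 1) = w.get j).card : ℝ) / N)
          atTop (nhds (((b : ℝ) ^ w.length)⁻¹)) := by
  rw [Measure.restrict_congr_set Ioo_ae_eq_Ico]
  simp only [ae_all_iff, eventually_imp_distrib_left]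
  intro b hb w hw0 hw
  filter_upwards [ae_tendsto_average_occurrenceIndicator (by omega) hw0 hw] with x hx
  simpa only [occurrenceIndicator_apply, Finset.sum_boole] using hx
end
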